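/- arXiv:2408.08233 — 3 statements merged into one kernel-verified Lean document; each statement's English description precedes it below -/
import Mathlib

section
/- Characterization of vanishing Z-Gromov–Wasserstein distance: Let (Z, d_Z) be a separable metric space and p ∈ [1,∞). For (Z,p)-networks X and Y, one has GW_p^Z(X,Y) = 0 if and only if X and Y are weakly isomorphic. -/
/-- A bundled `(Z,p)`-network: a Polish space with a Borel probability measure and a
Borel measurable kernel valued in `Z`, with finite `p`-th moment relative to some
(equivalently, every) base point `z₀ ∈ Z`. -/
structure PNetwork (Z : Type*) [MeasurableSpace Z] [PseudoMetricSpace Z] (p : ℝ) where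
  carrier : Type
  [mea : MeasurableSpace carrier]
  [top : TopologicalSpace carrier]
  [polish : PolishSpace carrier]
  [borel : BorelSpace carrier]
  μ : MeasureTheory.Measure carrier
  ω : carrier × carrier → Z
  prob : MeasureTheory.IsProbabilityMeasure μ
  meas : Measurable ω
  integ : ∃ z₀ : Z, (∫⁻ x, ∫⁻ x', ENNReal.ofReal (dist (ω (x, x')) z₀ ^ p) ∂μ ∂μ) < ⊤

attribute [instance] PNetwork.mea PNetwork.top PNetwork.polish PNetwork.borel

open MeasureTheory

/-- The set of couplings of two measures. -/
def Couplings {X Y : Type*} [MeasurableSpace X] [MeasurableSpace Y]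
    (μ : Measure X) (ν : Measure Y) : Set (Measure (X × Y)) :=
  {π | IsProbabilityMeasure π ∧ π.map Prod.fst = μ ∧ π.map Prod.snd = ν}

/-- The `p`-distortion of a coupling `π`. -/
noncomputable def dis {X Y Z : Type*} [MeasurableSpace X] [MeasurableSpace Y]
    [PseudoMetricSpace Z]
    (p : ℝ) (ωX : X × X → Z) (ωY : Y × Y → Z) (π : Measure (X × Y)) : ℝ :=
  (∫ w : X × Y, ∫ w' : X × Y,
      dist (ωX (w.1, w'.1)) (ωY (w.2, w'.2)) ^ p ∂π ∂π) ^ (1 / p)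

/-- The `Z`-Gromov–Wasserstein `p`-distance between network data. -/
noncomputable def GW {X Y Z : Type*} [MeasurableSpace X] [MeasurableSpace Y]
    [PseudoMetricSpace Z]
    (p : ℝ) (ωX : X × X → Z) (μX : Measure X) (ωY : Y × Y → Z) (μY : Measure Y) : ℝ :=
  (1 / 2) * sInf (dis p ωX ωY '' Couplings μX μY)

/-- The `Z`-Gromov–Wasserstein `p`-distance between bundled networks. -/
noncomputable def GWn {Z : Type*} [MeasurableSpace Z] [PseudoMetricSpace Z] {p : ℝ}
    (N M : PNetwork Z p) : ℝ :=
  GW p N.ω N.μ M.ω M.μ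

/-- Two `(Z,p)`-networks are weakly isomorphic if there are a `(Z,p)`-network `W` and
measure-preserving maps `φX : W → X`, `φY : W → Y` pulling the kernels of `X` and `Y`
back to the kernel of `W` almost everywhere. -/
def WeaklyIsomorphic {Z : Type*} [MeasurableSpace Z] [PseudoMetricSpace Z] {p : ℝ}
    (N M : PNetwork Z p) : Prop :=
  ∃ (W : PNetwork Z p) (φX : W.carrier → N.carrier) (φY : W.carrier → M.carrier),
    MeasurePreserving φX W.μ N.μ ∧
    MeasurePreserving φY W.μ M.μ ∧
    ∀ᵐ w ∂(W.μ.prod W.μ),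
      N.ω (φX w.1, φX w.2) = W.ω w ∧ M.ω (φY w.1, φY w.2) = W.ω w

open Filter Topology TopologicalSpace
open scoped ENNReal

section Couplings

variable {X Y : Type*} [MeasurableSpace X] [MeasurableSpace Y]

lemma prod_mem_couplings (μ : Measure X) (ν : Measure Y)
    [IsProbabilityMeasure μ] [IsProbabilityMeasure ν] : μ.prod ν ∈ Couplings μ ν :=
  ⟨inferInstance, by simp, by simp⟩

lemma measurePreserving_fst_of_mem_couplings {μ : Measure X} {ν : Measure Y}
    {π : Measure (X × Y)} (hπ : π ∈ Couplings μ ν) : MeasurePreserving Prod.fst π μ :=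
  ⟨measurable_fst, hπ.2.1⟩

lemma measurePreserving_snd_of_mem_couplings {μ : Measure X} {ν : Measure Y}
    {π : Measure (X × Y)} (hπ : π ∈ Couplings μ ν) : MeasurePreserving Prod.snd π ν :=
  ⟨measurable_snd, hπ.2.2⟩

lemma isTightMeasureSet_couplings [TopologicalSpace X] [PolishSpace X] [BorelSpace X]
    [TopologicalSpace Y] [PolishSpace Y] [BorelSpace Y] (μ : Measure X) (ν : Measure Y)
    [IsProbabilityMeasure μ] [IsProbabilityMeasure ν] :
    IsTightMeasureSet (Couplings μ ν) := by
  let := upgradeIsCompletelyMetrizable X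
  let := upgradeIsCompletelyMetrizable Y
  rw [isTightMeasureSet_iff_exists_isCompact_measure_compl_le]
  intro ε hε
  have hε2 : 0 < ε / 2 := ENNReal.half_pos hε.ne'
  obtain ⟨K, hK, hμK⟩ := isTightMeasureSet_iff_exists_isCompact_measure_compl_le.1
    (isTightMeasureSet_singleton (μ := μ)) (ε / 2) hε2
  obtain ⟨L, hL, hνL⟩ := isTightMeasureSet_iff_exists_isCompact_measure_compl_le.1
    (isTightMeasureSet_singleton (μ := ν)) (ε / 2) hε2
  refine ⟨K ×ˢ L, hK.prod hL, fun π hπ ↦ ?_⟩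
  calc π (K ×ˢ L)ᶜ ≤ π (Prod.fst ⁻¹' Kᶜ ∪ Prod.snd ⁻¹' Lᶜ) := by
        refine measure_mono fun w hw ↦ ?_
        by_contra h
        simp_all
    _ ≤ π (Prod.fst ⁻¹' Kᶜ) + π (Prod.snd ⁻¹' Lᶜ) := measure_union_le _ _
    _ = μ Kᶜ + ν Lᶜ := by
        rw [(measurePreserving_fst_of_mem_couplings hπ).measure_preimage
            hK.measurableSet.compl.nullMeasurableSet,
          (measurePreserving_snd_of_mem_couplings hπ).measure_preimage
            hL.measurableSet.compl.nullMeasurableSet]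
    _ ≤ ε / 2 + ε / 2 := add_le_add (hμK μ rfl) (hνL ν rfl)
    _ = ε := ENNReal.add_halves ε

/-- Couplings of two Borel probability measures on Polish spaces form a weakly compact set. -/
lemma isCompact_couplings [TopologicalSpace X] [PolishSpace X] [BorelSpace X]
    [TopologicalSpace Y] [PolishSpace Y] [BorelSpace Y] (μ : Measure X) (ν : Measure Y)
    [IsProbabilityMeasure μ] [IsProbabilityMeasure ν] :
    IsCompact {π : ProbabilityMeasure (X × Y) | (π : Measure (X × Y)) ∈ Couplings μ ν} := by
  let := upgradeIsCompletelyMetrizable X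
  let := upgradeIsCompletelyMetrizable Y
  set S := {π : ProbabilityMeasure (X × Y) | (π : Measure (X × Y)) ∈ Couplings μ ν}
  have hclosed : IsClosed S := by
    let μ' : ProbabilityMeasure X := ⟨μ, inferInstance⟩
    let ν' : ProbabilityMeasure Y := ⟨ν, inferInstance⟩
    have hS : S = {π | π.map measurable_fst.aemeasurable = μ'} ∩
        {π | π.map measurable_snd.aemeasurable = ν'} := by
      ext π
      exact ⟨fun h ↦ ⟨Subtype.ext h.2.1, Subtype.ext h.2.2⟩,
        fun h ↦ ⟨π.2, congrArg Subtype.val h.1, congrArg Subtype.val h.2⟩⟩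
    rw [hS]
    exact (isClosed_eq (ProbabilityMeasure.continuous_map continuous_fst) continuous_const).inter
      (isClosed_eq (ProbabilityMeasure.continuous_map continuous_snd) continuous_const)
  rw [← hclosed.closure_eq]
  refine isCompact_closure_of_isTightMeasureSet ((isTightMeasureSet_couplings μ ν).subset ?_)
  rintro _ ⟨π, hπ, rfl⟩
  exact hπ

end Couplings

section Discrepancy

variable {X Y : Type*} [MeasurableSpace X] [MeasurableSpace Y]

/-- The `L¹`-discrepancy of two real-valued kernels under a measure on the product. -/
noncomputable def kernelDiscrepancy (f : X × X → ℝ) (g : Y × Y → ℝ) (π : Measure (X × Y)) : ℝ≥0∞ :=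
  ∫⁻ v, ‖f (v.1.1, v.2.1) - g (v.1.2, v.2.2)‖ₑ ∂(π.prod π)

lemma measurePreserving_fst_fst {μ : Measure X} {ν : Measure Y} {π : Measure (X × Y)}
    [IsProbabilityMeasure μ] (hπ : π ∈ Couplings μ ν) :
    MeasurePreserving (fun v : (X × Y) × (X × Y) ↦ (v.1.1, v.2.1)) (π.prod π) (μ.prod μ) :=
  have := hπ.1
  (measurePreserving_fst_of_mem_couplings hπ).prod (measurePreserving_fst_of_mem_couplings hπ)

lemma measurePreserving_snd_snd {μ : Measure X} {ν : Measure Y} {π : Measure (X × Y)}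
    [IsProbabilityMeasure ν] (hπ : π ∈ Couplings μ ν) :
    MeasurePreserving (fun v : (X × Y) × (X × Y) ↦ (v.1.2, v.2.2)) (π.prod π) (ν.prod ν) :=
  have := hπ.1
  (measurePreserving_snd_of_mem_couplings hπ).prod (measurePreserving_snd_of_mem_couplings hπ)

lemma kernelDiscrepancy_le {μ : Measure X} {ν : Measure Y} [IsProbabilityMeasure μ]
    [IsProbabilityMeasure ν] {π : Measure (X × Y)} (hπ : π ∈ Couplings μ ν)
    {f f' : X × X → ℝ} {g g' : Y × Y → ℝ} (hf : AEStronglyMeasurable f (μ.prod μ))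
    (hf' : AEStronglyMeasurable f' (μ.prod μ)) (hg : AEStronglyMeasurable g (ν.prod ν))
    (hg' : AEStronglyMeasurable g' (ν.prod ν)) :
    kernelDiscrepancy f g π ≤ (∫⁻ x, ‖f x - f' x‖ₑ ∂(μ.prod μ)) + kernelDiscrepancy f' g' π +
      ∫⁻ y, ‖g y - g' y‖ₑ ∂(ν.prod ν) := by
  have hX := measurePreserving_fst_fst hπ
  have hY := measurePreserving_snd_snd hπ
  have hff : AEMeasurable (fun x ↦ ‖f x - f' x‖ₑ) (μ.prod μ) := (hf.sub hf').enorm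
  have hgg : AEMeasurable (fun x ↦ ‖g x - g' x‖ₑ) (ν.prod ν) := (hg.sub hg').enorm
  rw [← hX.map_eq, lintegral_map' (by rwa [hX.map_eq]) hX.aemeasurable,
    ← hY.map_eq, lintegral_map' (by rwa [hY.map_eq]) hY.aemeasurable]
  have hff' := hff.comp_quasiMeasurePreserving hX.quasiMeasurePreserving
  have hgg' := hgg.comp_quasiMeasurePreserving hY.quasiMeasurePreserving
  simp only [Function.comp_def] at hff' hgg'
  unfold kernelDiscrepancy
  rw [← lintegral_add_left' hff', ← lintegral_add_right' _ hgg']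
  refine lintegral_mono fun v ↦ ?_
  dsimp only
  set a := f (v.1.1, v.2.1)
  set a' := f' (v.1.1, v.2.1)
  set b := g (v.1.2, v.2.2)
  set b' := g' (v.1.2, v.2.2)
  calc ‖a - b‖ₑ = ‖(a - a') + (a' - b') - (b - b')‖ₑ := by congr 1; ring
    _ ≤ ‖(a - a') + (a' - b')‖ₑ + ‖b - b'‖ₑ := enorm_sub_le
    _ ≤ _ := by gcongr; exact enorm_add_le _ _

lemma tendsto_kernelDiscrepancy_boundedContinuous
    [TopologicalSpace X] [PolishSpace X] [BorelSpace X]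
    [TopologicalSpace Y] [PolishSpace Y] [BorelSpace Y]
    (f : BoundedContinuousFunction (X × X) ℝ) (g : BoundedContinuousFunction (Y × Y) ℝ)
    {ι : Type*} {l : Filter ι} {u : ι → ProbabilityMeasure (X × Y)}
    {π : ProbabilityMeasure (X × Y)} (hu : Tendsto u l (𝓝 π)) :
    Tendsto (fun i ↦ kernelDiscrepancy f g (u i)) l (𝓝 (kernelDiscrepancy f g π)) := by
  have hprod : Tendsto (fun i ↦ (u i).prod (u i)) l (𝓝 (π.prod π)) :=
    (ProbabilityMeasure.continuous_prod.tendsto (π, π)).comp (hu.prodMk_nhds hu)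
  let F : C((X × Y) × (X × Y), X × X) := ⟨fun v ↦ (v.1.1, v.2.1), by fun_prop⟩
  let G : C((X × Y) × (X × Y), Y × Y) := ⟨fun v ↦ (v.1.2, v.2.2), by fun_prop⟩
  let h : BoundedContinuousFunction ((X × Y) × (X × Y)) NNReal :=
    (f.compContinuous F - g.compContinuous G).comp _ lipschitzWith_one_nnnorm
  exact ProbabilityMeasure.tendsto_iff_forall_lintegral_tendsto.1 hprod h

/-- Along weakly convergent couplings, vanishing of the `L¹`-discrepancy of two integrable
(possibly discontinuous) kernels passes to the limit. -/
lemma kernelDiscrepancy_eq_zero_of_tendsto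
    [TopologicalSpace X] [PolishSpace X] [BorelSpace X]
    [TopologicalSpace Y] [PolishSpace Y] [BorelSpace Y]
    {μ : Measure X} {ν : Measure Y} [IsProbabilityMeasure μ] [IsProbabilityMeasure ν]
    {f : X × X → ℝ} {g : Y × Y → ℝ} (hf : Integrable f (μ.prod μ)) (hg : Integrable g (ν.prod ν))
    {ι : Type*} {l : Filter ι} [l.NeBot] {u : ι → ProbabilityMeasure (X × Y)}
    {π : ProbabilityMeasure (X × Y)} (hu : Tendsto u l (𝓝 π))
    (hucoup : ∀ i, (u i : Measure (X × Y)) ∈ Couplings μ ν)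
    (hπ : (π : Measure (X × Y)) ∈ Couplings μ ν)
    (hzero : Tendsto (fun i ↦ kernelDiscrepancy f g (u i)) l (𝓝 0)) :
    kernelDiscrepancy f g π = 0 := by
  let := upgradeIsCompletelyMetrizable X
  let := upgradeIsCompletelyMetrizable Y
  refine nonpos_iff_eq_zero.1 (ENNReal.le_of_forall_pos_le_add fun ε hε _ ↦ ?_)
  set δ : ℝ≥0∞ := (ε : ℝ≥0∞) / 4 with hδ
  have hδ0 : δ ≠ 0 := by simp [hδ, hε.ne']
  obtain ⟨F, hF, hFi⟩ := hf.exists_boundedContinuous_lintegral_sub_le hδ0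
  obtain ⟨G, hG, hGi⟩ := hg.exists_boundedContinuous_lintegral_sub_le hδ0
  have hlim : kernelDiscrepancy F G π ≤ δ + 0 + δ := by
    refine le_of_tendsto_of_tendsto' (tendsto_kernelDiscrepancy_boundedContinuous F G hu)
      ((tendsto_const_nhds.add hzero).add tendsto_const_nhds) fun i ↦ ?_
    refine (kernelDiscrepancy_le (hucoup i) hFi.1 hf.1 hGi.1 hg.1).trans ?_
    gcongr
    · simpa only [enorm_sub_rev] using hF
    · simpa only [enorm_sub_rev] using hG
  calc kernelDiscrepancy f g π ≤ δ + (δ + 0 + δ) + δ := by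
        refine (kernelDiscrepancy_le hπ hf.1 hFi.1 hg.1 hGi.1).trans ?_
        gcongr
    _ = 4 * δ := by ring
    _ = 0 + ε := by rw [hδ, zero_add, ENNReal.mul_div_cancel (by simp) (by simp)]

end Discrepancy

lemma dis_nonneg {X Y Z : Type*} [MeasurableSpace X] [MeasurableSpace Y]
    [PseudoMetricSpace Z] (p : ℝ) (ωX : X × X → Z) (ωY : Y × Y → Z) (π : Measure (X × Y)) :
    0 ≤ dis p ωX ωY π :=
  Real.rpow_nonneg (integral_nonneg fun _ ↦ integral_nonneg fun _ ↦ by positivity) _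

namespace PNetwork

variable {Z : Type*} [MetricSpace Z] [MeasurableSpace Z] {p : ℝ}

instance (N : PNetwork Z p) : IsProbabilityMeasure N.μ := N.prob

variable {N M : PNetwork Z p}

lemma dis_eq_zero (hp : p ≠ 0) {π : Measure (N.carrier × M.carrier)} [SFinite π]
    (h : ∀ᵐ v ∂(π.prod π), N.ω (v.1.1, v.2.1) = M.ω (v.1.2, v.2.2)) :
    dis p N.ω M.ω π = 0 := by
  have hzero : ∫ w, ∫ w', dist (N.ω (w.1, w'.1)) (M.ω (w.2, w'.2)) ^ p ∂π ∂π = 0 := by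
    refine integral_eq_zero_of_ae ?_
    filter_upwards [Measure.ae_ae_of_ae_prod h] with w hw
    refine integral_eq_zero_of_ae ?_
    filter_upwards [hw] with w' hw'
    simp [hw', Real.zero_rpow hp]
  rw [dis, hzero, Real.zero_rpow (one_div_ne_zero hp)]

lemma exists_coupling_dis_lt (h : GWn N M = 0) {ε : ℝ} (hε : 0 < ε) :
    ∃ π ∈ Couplings N.μ M.μ, dis p N.ω M.ω π < ε := by
  have hinf : sInf (dis p N.ω M.ω '' Couplings N.μ M.μ) < ε := by
    have : sInf (dis p N.ω M.ω '' Couplings N.μ M.μ) = 0 := by simpa [GWn, GW] using h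
    rwa [this]
  obtain ⟨_, ⟨π, hπ, rfl⟩, hlt⟩ :=
    exists_lt_of_csInf_lt (Set.Nonempty.image _ ⟨_, prod_mem_couplings N.μ M.μ⟩) hinf
  exact ⟨π, hπ, hlt⟩

lemma GWn_eq_zero_of_ae_eq (hp : p ≠ 0) {π : Measure (N.carrier × M.carrier)}
    (hπ : π ∈ Couplings N.μ M.μ)
    (h : ∀ᵐ v ∂(π.prod π), N.ω (v.1.1, v.2.1) = M.ω (v.1.2, v.2.2)) : GWn N M = 0 := by
  have := hπ.1
  have hleast : IsLeast (dis p N.ω M.ω '' Couplings N.μ M.μ) 0 := by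
    refine ⟨⟨π, hπ, dis_eq_zero hp h⟩, ?_⟩
    rintro _ ⟨σ, -, rfl⟩
    exact dis_nonneg _ _ _ _
  rw [GWn, GW, hleast.csInf_eq, mul_zero]

variable [BorelSpace Z] [SecondCountableTopology Z]

lemma memLp_dist (hp : 1 ≤ p) (N : PNetwork Z p) (z : Z) :
    MemLp (fun x ↦ dist (N.ω x) z) (ENNReal.ofReal p) (N.μ.prod N.μ) := by
  obtain ⟨z₀, hz₀⟩ := N.integ
  have hp0 : 0 < p := zero_lt_one.trans_le hp
  have hmeas (z : Z) : Measurable fun x ↦ dist (N.ω x) z := N.meas.dist measurable_const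
  have h₀ : MemLp (fun x ↦ dist (N.ω x) z₀) (ENNReal.ofReal p) (N.μ.prod N.μ) := by
    refine ⟨(hmeas z₀).aestronglyMeasurable, ?_⟩
    rw [eLpNorm_lt_top_iff_lintegral_rpow_enorm_lt_top (by simpa using hp0) (by simp),
      ENNReal.toReal_ofReal hp0.le, lintegral_prod _ ((hmeas z₀).enorm.pow_const p).aemeasurable]
    convert hz₀ using 5
    rw [Real.enorm_of_nonneg dist_nonneg, ENNReal.ofReal_rpow_of_nonneg dist_nonneg hp0.le]
  refine (h₀.add (memLp_const (dist z₀ z))).mono (hmeas z).aestronglyMeasurable (ae_of_all _ ?_)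
  intro x
  simp only [Pi.add_apply, Real.norm_of_nonneg dist_nonneg,
    Real.norm_of_nonneg (add_nonneg dist_nonneg dist_nonneg)]
  exact dist_triangle _ _ _

lemma measurable_dist_kernels (N M : PNetwork Z p) :
    Measurable fun v : (N.carrier × M.carrier) × (N.carrier × M.carrier) ↦
      dist (N.ω (v.1.1, v.2.1)) (M.ω (v.1.2, v.2.2)) :=
  (N.meas.comp (by fun_prop)).dist (M.meas.comp (by fun_prop))

lemma memLp_dist_kernels (hp : 1 ≤ p) {π : Measure (N.carrier × M.carrier)}
    (hπ : π ∈ Couplings N.μ M.μ) :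
    MemLp (fun v : (N.carrier × M.carrier) × (N.carrier × M.carrier) ↦
      dist (N.ω (v.1.1, v.2.1)) (M.ω (v.1.2, v.2.2))) (ENNReal.ofReal p) (π.prod π) := by
  obtain ⟨z, -⟩ := N.integ
  have hN := (N.memLp_dist hp z).comp_measurePreserving (measurePreserving_fst_fst hπ)
  have hM := (M.memLp_dist hp z).comp_measurePreserving (measurePreserving_snd_snd hπ)
  refine (hN.add hM).mono (measurable_dist_kernels N M).aestronglyMeasurable (ae_of_all _ ?_)
  intro v
  simp only [Pi.add_apply, Function.comp_apply, Real.norm_of_nonneg dist_nonneg,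
    Real.norm_of_nonneg (add_nonneg dist_nonneg dist_nonneg)]
  exact dist_triangle_right _ _ _

lemma eLpNorm_dist_kernels (hp : 1 ≤ p) {π : Measure (N.carrier × M.carrier)}
    (hπ : π ∈ Couplings N.μ M.μ) :
    eLpNorm (fun v : (N.carrier × M.carrier) × (N.carrier × M.carrier) ↦
      dist (N.ω (v.1.1, v.2.1)) (M.ω (v.1.2, v.2.2))) (ENNReal.ofReal p) (π.prod π) =
      ENNReal.ofReal (dis p N.ω M.ω π) := by
  have hp0 : 0 < p := zero_lt_one.trans_le hp
  have := hπ.1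
  have hmem := memLp_dist_kernels hp hπ
  have hint := hmem.integrable_norm_rpow (by simpa using hp0) (by simp)
  rw [hmem.eLpNorm_eq_integral_rpow_norm (by simpa using hp0) (by simp), integral_prod _ hint,
    ENNReal.toReal_ofReal hp0.le, dis, one_div]
  simp only [Real.norm_of_nonneg dist_nonneg]

lemma kernelDiscrepancy_dist_le_dis (hp : 1 ≤ p) {π : Measure (N.carrier × M.carrier)}
    (hπ : π ∈ Couplings N.μ M.μ) (z : Z) :
    kernelDiscrepancy (fun x ↦ dist (N.ω x) z) (fun y ↦ dist (M.ω y) z) π ≤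
      ENNReal.ofReal (dis p N.ω M.ω π) := by
  have := hπ.1
  rw [← eLpNorm_dist_kernels hp hπ]
  refine le_trans ?_ (eLpNorm_le_eLpNorm_of_exponent_le (p := 1) (by simpa using hp)
    (measurable_dist_kernels N M).aestronglyMeasurable)
  rw [eLpNorm_one_eq_lintegral_enorm]
  refine lintegral_mono fun v ↦ ?_
  rw [enorm_le_iff_norm_le, Real.norm_eq_abs, Real.norm_of_nonneg dist_nonneg]
  exact abs_dist_sub_le _ _ _

lemma ae_eq_kernels_of_kernelDiscrepancy_eq_zero {π : Measure (N.carrier × M.carrier)}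
    (h : ∀ z, kernelDiscrepancy (fun x ↦ dist (N.ω x) z) (fun y ↦ dist (M.ω y) z) π = 0) :
    ∀ᵐ v ∂(π.prod π), N.ω (v.1.1, v.2.1) = M.ω (v.1.2, v.2.2) := by
  have : Nonempty Z := ⟨N.integ.choose⟩
  have hae : ∀ᵐ v ∂(π.prod π), ∀ k, dist (N.ω (v.1.1, v.2.1)) (denseSeq Z k) =
      dist (M.ω (v.1.2, v.2.2)) (denseSeq Z k) := by
    refine ae_all_iff.2 fun k ↦ ?_
    have hN := (N.meas.comp (f := fun v : (N.carrier × M.carrier) × (N.carrier × M.carrier) ↦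
      (v.1.1, v.2.1)) (by fun_prop)).dist (measurable_const (a := denseSeq Z k))
    have hM := (M.meas.comp (f := fun v : (N.carrier × M.carrier) × (N.carrier × M.carrier) ↦
      (v.1.2, v.2.2)) (by fun_prop)).dist (measurable_const (a := denseSeq Z k))
    have hk := (lintegral_eq_zero_iff (hN.sub hM).enorm).1 (h (denseSeq Z k))
    filter_upwards [hk] with v hv
    exact sub_eq_zero.1 (enorm_eq_zero.1 hv)
  filter_upwards [hae] with v hv
  have hdist : (fun z ↦ dist (N.ω (v.1.1, v.2.1)) z) = fun z ↦ dist (M.ω (v.1.2, v.2.2)) z :=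
    (denseRange_denseSeq Z).equalizer (by fun_prop) (by fun_prop) (funext hv)
  simpa [eq_comm] using congrFun hdist (N.ω (v.1.1, v.2.1))

/-- The network structure on `N.carrier × M.carrier` induced by a coupling and the kernel of `N`. -/
def ofCoupling {π : Measure (N.carrier × M.carrier)} (hπ : π ∈ Couplings N.μ M.μ) :
    PNetwork Z p where
  carrier := N.carrier × M.carrier
  μ := π
  ω v := N.ω (v.1.1, v.2.1)
  prob := hπ.1
  meas := N.meas.comp (by fun_prop)
  integ := by
    obtain ⟨z₀, hz₀⟩ := N.integ
    have := hπ.1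
    have hfst := measurePreserving_fst_of_mem_couplings hπ
    have hmeas : Measurable fun x ↦ ENNReal.ofReal (dist (N.ω x) z₀ ^ p) :=
      ((N.meas.dist measurable_const).pow_const p).ennreal_ofReal
    refine ⟨z₀, lt_of_eq_of_lt ?_ hz₀⟩
    rw [← hfst.lintegral_comp hmeas.lintegral_prod_right']
    refine lintegral_congr fun w ↦ ?_
    exact hfst.lintegral_comp (hmeas.comp (measurable_prodMk_left (x := w.1)))

lemma weaklyIsomorphic_of_ae_eq {π : Measure (N.carrier × M.carrier)}
    (hπ : π ∈ Couplings N.μ M.μ)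
    (h : ∀ᵐ v ∂(π.prod π), N.ω (v.1.1, v.2.1) = M.ω (v.1.2, v.2.2)) : WeaklyIsomorphic N M := by
  refine ⟨ofCoupling hπ, Prod.fst, Prod.snd, measurePreserving_fst_of_mem_couplings hπ,
    measurePreserving_snd_of_mem_couplings hπ, ?_⟩
  change ∀ᵐ v ∂(π.prod π), _
  filter_upwards [h] with v hv using ⟨rfl, hv.symm⟩

lemma exists_coupling_ae_eq_of_weaklyIsomorphic (h : WeaklyIsomorphic N M) :
    ∃ π ∈ Couplings N.μ M.μ,
      ∀ᵐ v ∂(π.prod π), N.ω (v.1.1, v.2.1) = M.ω (v.1.2, v.2.2) := by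
  obtain ⟨W, φ, ψ, hφ, hψ, hW⟩ := h
  have hφψ : Measurable fun w ↦ (φ w, ψ w) := hφ.measurable.prodMk hψ.measurable
  refine ⟨W.μ.map fun w ↦ (φ w, ψ w), ⟨Measure.isProbabilityMeasure_map hφψ.aemeasurable, ?_, ?_⟩,
    ?_⟩
  · rw [Measure.map_map measurable_fst hφψ]
    exact hφ.map_eq
  · rw [Measure.map_map measurable_snd hφψ]
    exact hψ.map_eq
  · rw [Measure.map_prod_map _ _ hφψ hφψ, ae_map_iff (hφψ.prodMap hφψ).aemeasurable]
    · filter_upwards [hW] with w hw using hw.1.trans hw.2.symm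
    · exact measurableSet_eq_fun (N.meas.comp (by fun_prop)) (M.meas.comp (by fun_prop))

lemma exists_coupling_ae_eq_of_GWn_eq_zero (hp : 1 ≤ p) (h : GWn N M = 0) :
    ∃ π ∈ Couplings N.μ M.μ,
      ∀ᵐ v ∂(π.prod π), N.ω (v.1.1, v.2.1) = M.ω (v.1.2, v.2.2) := by
  choose π hπ hlt using fun n : ℕ ↦
    exists_coupling_dis_lt h (Nat.one_div_pos_of_nat (α := ℝ) (n := n))
  let u (n : ℕ) : ProbabilityMeasure (N.carrier × M.carrier) := ⟨π n, (hπ n).1⟩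
  obtain ⟨ρ, hρ, s, hs, hlim⟩ := (isCompact_couplings N.μ M.μ).tendsto_subseq (x := u) hπ
  refine ⟨ρ, hρ, ae_eq_kernels_of_kernelDiscrepancy_eq_zero fun z ↦ ?_⟩
  have hint (K : PNetwork Z p) : Integrable (fun x ↦ dist (K.ω x) z) (K.μ.prod K.μ) :=
    (K.memLp_dist hp z).integrable (by simpa using hp)
  refine kernelDiscrepancy_eq_zero_of_tendsto (hint N) (hint M) hlim (fun n ↦ hπ (s n)) hρ ?_
  have hdis : Tendsto (fun n ↦ ENNReal.ofReal (dis p N.ω M.ω (π n))) atTop (𝓝 0) := by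
    rw [← ENNReal.ofReal_zero]
    exact ENNReal.tendsto_ofReal (squeeze_zero (fun n ↦ dis_nonneg _ _ _ _)
      (fun n ↦ (hlt n).le) tendsto_one_div_add_atTop_nhds_zero_nat)
  exact tendsto_of_tendsto_of_tendsto_of_le_of_le tendsto_const_nhds
    (hdis.comp hs.tendsto_atTop) (fun _ ↦ zero_le)
    fun n ↦ kernelDiscrepancy_dist_le_dis hp (hπ (s n)) z

end PNetwork

/-- **Characterization of vanishing `Z`-Gromov–Wasserstein distance**: for a separable
metric space `Z` and `p ∈ [1,∞)`, two `(Z,p)`-networks are at `GW_p^Z`-distance zero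
if and only if they are weakly isomorphic. -/
theorem gw_eq_zero_iff_weaklyIsomorphic
    {Z : Type*} [MetricSpace Z] [MeasurableSpace Z] [BorelSpace Z]
    [TopologicalSpace.SeparableSpace Z]
    (p : ℝ) (hp : 1 ≤ p) (N M : PNetwork Z p) :
    GWn N M = 0 ↔ WeaklyIsomorphic N M := by
  have : SecondCountableTopology Z := UniformSpace.secondCountable_of_separable Z
  constructor
  · intro h
    obtain ⟨π, hπ, hae⟩ := PNetwork.exists_coupling_ae_eq_of_GWn_eq_zero hp h
    exact PNetwork.weaklyIsomorphic_of_ae_eq hπ hae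
  · intro h
    obtain ⟨π, hπ, hae⟩ := PNetwork.exists_coupling_ae_eq_of_weaklyIsomorphic h
    exact PNetwork.GWn_eq_zero_of_ae_eq (by linarith) hπ hae
end

section
/- Completeness transfer: Let (Z, d_Z) be a separable metric space and p ∈ [1,∞). The following are equivalent: (i) (Z, d_Z) is a complete metric space; (ii) every sequence (X_n) of (Z,p)-networks which is Cauchy with respect to GW_p^Z (i.e. for every ε > 0 there is N with GW_p^Z(X_n, X_m) < ε for all n, m ≥ N) admits a (Z,p)-network X with GW_p^Z(X_n, X) → 0 as n → ∞. -/
open MeasureTheory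

open MeasureTheory ProbabilityTheory Filter Topology
open scoped ENNReal unitInterval

theorem exists_measurable_map_prod_volume_eq {X Y : Type*} [MeasurableSpace X]
    [MeasurableSpace Y] [StandardBorelSpace Y] [Nonempty Y]
    (π : Measure (X × Y)) [IsProbabilityMeasure π] :
    ∃ F : X × I → Y, Measurable F ∧
      ((π.map Prod.fst).prod (volume : Measure I)).map (fun q => (q.1, F q)) = π := by
  obtain ⟨f, hf, hmap⟩ := Kernel.exists_measurable_map_eq_unitInterval π.condKernel
  refine ⟨Function.uncurry f, hf, ?_⟩
  conv_rhs => rw [← π.disintegrate π.condKernel]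
  change Measure.map _ (π.fst.prod volume) = _
  ext s hs
  rw [Measure.map_apply (by fun_prop) hs, Measure.prod_apply (by measurability),
    Measure.compProd_apply hs]
  refine lintegral_congr fun x => ?_
  have hfx : Measurable (f x) := hf.comp measurable_prodMk_left
  rw [← hmap x, Measure.map_apply hfx (measurable_prodMk_left hs)]
  rfl

theorem exists_map_prodMk_succ_eq {X : ℕ → Type*} [∀ n, MeasurableSpace (X n)]
    [∀ n, StandardBorelSpace (X n)] [∀ n, Nonempty (X n)] (μ : ∀ n, Measure (X n))
    (π : ∀ n, Measure (X n × X (n + 1))) [∀ n, IsProbabilityMeasure (π n)]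
    (hfst : ∀ n, (π n).map Prod.fst = μ n) (hsnd : ∀ n, (π n).map Prod.snd = μ (n + 1)) :
    ∃ f : ∀ n, (ℕ → I) → X n, (∀ n, Measurable (f n)) ∧
      ∀ n, (Measure.infinitePi fun _ : ℕ => (volume : Measure I)).map
        (fun u => (f n u, f (n + 1) u)) = π n := by
  set P := Measure.infinitePi fun _ : ℕ => (volume : Measure I) with hP
  choose F hF hFmap using fun n => exists_measurable_map_prod_volume_eq (π n)
  have hμ : IsProbabilityMeasure (μ 0) := by
    rw [← hfst]; exact Measure.isProbabilityMeasure_map (by fun_prop)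
  obtain ⟨g, hg, hgmap⟩ := (μ 0).exists_measurable_map_eq
  let f : ∀ n, (ℕ → I) → X n := fun n u =>
    Nat.rec (motive := X) (g (u 0)) (fun n x => F n (x, u (n + 1))) n
  have hf0 : ∀ u, f 0 u = g (u 0) := fun u => rfl
  have hfs : ∀ n u, f (n + 1) u = F n (f n u, u (n + 1)) := fun n u => rfl
  have hfact : ∀ n, ∃ h : (Finset.range (n + 1) → I) → X n, Measurable h ∧
      ∀ u, f n u = h (fun i => u i) := by
    intro n
    induction n with
    | zero => exact ⟨fun v => g (v ⟨0, by simp⟩), by fun_prop, fun u => hf0 u⟩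
    | succ n ih =>
      obtain ⟨h, hh, hfh⟩ := ih
      refine ⟨fun v => F n (h (fun i => v ⟨i, by have := i.2; grind⟩), v ⟨n + 1, by simp⟩),
        ?_, fun u => by rw [hfs, hfh]⟩
      fun_prop
  have hfm : ∀ n, Measurable (f n) := by
    intro n
    obtain ⟨h, hh, hfh⟩ := hfact n
    rw [funext hfh]
    fun_prop
  have hindep : ∀ n, IndepFun (f n) (fun u : ℕ → I => u (n + 1)) P := by
    intro n
    obtain ⟨h, hh, hfh⟩ := hfact n
    have hi : iIndepFun (fun (i : ℕ) (u : ℕ → I) => u i) P :=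
      iIndepFun_infinitePi (X := fun _ x => x) (fun _ => measurable_id)
    have := (hi.indepFun_finset (Finset.range (n + 1)) {n + 1} (by simp)
      (fun i => measurable_pi_apply i)).comp hh
      (measurable_pi_apply (⟨n + 1, by simp⟩ : ({n + 1} : Finset ℕ)))
    rw [funext hfh]
    exact this
  have hstep : ∀ n, P.map (f n) = μ n → P.map (fun u => (f n u, f (n + 1) u)) = π n := by
    intro n hn
    have h1 : P.map (fun u => (f n u, u (n + 1))) = (μ n).prod volume := by
      rw [(hindep n).map_prod_eq_prod_map_map (hfm n).aemeasurable
        (measurable_pi_apply _).aemeasurable, hn,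
        Measure.infinitePi_map_eval]
    rw [← hFmap n, hfst, ← h1, Measure.map_map (by fun_prop) (by fun_prop)]
    rfl
  have hlaw : ∀ n, P.map (f n) = μ n := by
    intro n
    induction n with
    | zero =>
      rw [← hgmap, ← Measure.infinitePi_map_eval (fun _ : ℕ => (volume : Measure I)) 0,
        Measure.map_map hg (by fun_prop)]
      rfl
    | succ n ih =>
      rw [← hsnd, ← hstep n ih, Measure.map_map (by fun_prop) (by fun_prop)]
      rfl
  exact ⟨f, hfm, fun n => hstep n (hlaw n)⟩

/-- The `L^q` distance between two maps into a metric space. -/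
noncomputable def eLpDist {W Z : Type*} [MeasurableSpace W] [PseudoMetricSpace Z]
    (a b : W → Z) (q : ℝ≥0∞) (Q : Measure W) : ℝ≥0∞ :=
  eLpNorm (fun w => dist (a w) (b w)) q Q

section eLpDist

variable {W W' Z : Type*} [MeasurableSpace W] [MeasurableSpace W'] [MetricSpace Z]
  [MeasurableSpace Z] [BorelSpace Z] [SecondCountableTopology Z]
  {q : ℝ≥0∞} {Q : Measure W} {Q' : Measure W'}

theorem eLpDist_triangle {a b c : W → Z} (hq : 1 ≤ q) (ha : Measurable a) (hb : Measurable b)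
    (hc : Measurable c) : eLpDist a c q Q ≤ eLpDist a b q Q + eLpDist b c q Q := by
  refine le_trans (eLpNorm_mono_real fun w => ?_)
    (eLpNorm_add_le (ha.dist hb).aestronglyMeasurable (hb.dist hc).aestronglyMeasurable hq)
  rw [Real.norm_of_nonneg dist_nonneg]
  exact dist_triangle _ _ _

theorem eLpDist_comp {a b : W' → Z} {φ : W → W'} (ha : Measurable a) (hb : Measurable b)
    (hφ : MeasurePreserving φ Q Q') :
    eLpDist (a ∘ φ) (b ∘ φ) q Q = eLpDist a b q Q' :=
  eLpNorm_comp_measurePreserving (g := fun w => dist (a w) (b w))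
    (ha.dist hb).aestronglyMeasurable hφ

theorem eLpDist_le_sum {a : ℕ → W → Z} {B : ℕ → ℝ≥0∞} (hq : 1 ≤ q) (ha : ∀ n, Measurable (a n))
    (h : ∀ n, eLpDist (a n) (a (n + 1)) q Q ≤ B n) (n m : ℕ) :
    eLpDist (a n) (a (n + m)) q Q ≤ ∑ i ∈ Finset.range m, B (i + n) := by
  induction m with
  | zero => simp [eLpDist]
  | succ m ih =>
    rw [Finset.sum_range_succ]
    refine (eLpDist_triangle hq (ha _) (ha (n + m)) (ha _)).trans (add_le_add ih ?_)
    rw [add_comm m n]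
    exact h (n + m)

theorem ae_exists_tendsto_of_eLpDist_le [CompleteSpace Z] [IsProbabilityMeasure Q]
    {a : ℕ → W → Z} {B : ℕ → ℝ≥0∞}
    (hq : 1 ≤ q) (ha : ∀ n, Measurable (a n)) (hB : ∑' n, B n ≠ ∞)
    (h : ∀ n, eLpDist (a n) (a (n + 1)) q Q ≤ B n) :
    ∀ᵐ w ∂Q, ∃ z, Tendsto (fun n => a n w) atTop (𝓝 z) := by
  have hfinite : ∫⁻ w, ∑' n, edist (a n w) (a (n + 1) w) ∂Q ≠ ∞ := by
    rw [lintegral_tsum fun n => ((ha n).edist (ha (n + 1))).aemeasurable]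
    refine ne_top_of_le_ne_top hB (ENNReal.tsum_le_tsum fun n => le_trans ?_ (h n))
    refine le_trans (le_of_eq ?_) (eLpNorm_le_eLpNorm_of_exponent_le hq
      ((ha n).dist (ha (n + 1))).aestronglyMeasurable)
    rw [eLpNorm_one_eq_lintegral_enorm]
    refine lintegral_congr fun w => ?_
    rw [edist_dist, Real.enorm_of_nonneg dist_nonneg]
  have hm : AEMeasurable (fun w => ∑' n, edist (a n w) (a (n + 1) w)) Q :=
    (Measurable.tsum fun n => (ha n).edist (ha (n + 1))).aemeasurable
  filter_upwards [ae_lt_top' hm hfinite] with w hw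
  exact cauchySeq_tendsto_of_complete
    (cauchySeq_of_edist_le_of_tsum_ne_top _ (fun n => le_rfl) hw.ne)

theorem exists_tendsto_eLpDist [CompleteSpace Z] [IsProbabilityMeasure Q]
    {a : ℕ → W → Z} {B : ℕ → ℝ≥0∞}
    (hq : 1 ≤ q) (ha : ∀ n, Measurable (a n)) (hB : ∑' n, B n ≠ ∞)
    (h : ∀ n, eLpDist (a n) (a (n + 1)) q Q ≤ B n) :
    ∃ b : W → Z, Measurable b ∧ Tendsto (fun n => eLpDist (a n) b q Q) atTop (𝓝 0) := by
  obtain ⟨b, hb, hlim⟩ := measurable_limit_of_tendsto_metrizable_ae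
    (fun n => (ha n).aemeasurable) (ae_exists_tendsto_of_eLpDist_le hq ha hB h)
  refine ⟨b, hb, tendsto_of_tendsto_of_tendsto_of_le_of_le tendsto_const_nhds
    (ENNReal.tendsto_sum_nat_add B hB) (fun _ => zero_le) fun n => ?_⟩
  refine Lp.eLpNorm_le_of_ae_tendsto (u := atTop)
    (f := fun m w => dist (a n w) (a (n + m) w)) (Eventually.of_forall fun m => ?_)
    (fun m => ((ha n).dist (ha _)).aestronglyMeasurable) ?_
  · exact (eLpDist_le_sum hq ha h n m).trans (ENNReal.sum_le_tsum _)
  · filter_upwards [hlim] with w hw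
    have hs : Tendsto (fun m => a (n + m) w) atTop (𝓝 (b w)) := by
      simpa [add_comm] using (tendsto_add_atTop_iff_nat n).2 hw
    exact tendsto_const_nhds.dist hs

end eLpDist

section Networks

variable {Z : Type*} [MetricSpace Z] [MeasurableSpace Z] {p : ℝ}

instance (N : PNetwork Z p) : IsProbabilityMeasure N.μ := N.prob

instance (N : PNetwork Z p) : Nonempty N.carrier := nonempty_of_isProbabilityMeasure N.μ

/-- The pullback along `f` of the kernel of a network. -/
def PNetwork.pullback (N : PNetwork Z p) {Ω : Type*} (f : Ω → N.carrier) : Ω × Ω → Z :=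
  N.ω ∘ Prod.map f f

theorem PNetwork.measurable_pullback (N : PNetwork Z p) {Ω : Type*} [MeasurableSpace Ω]
    {f : Ω → N.carrier} (hf : Measurable f) : Measurable (N.pullback f) :=
  N.meas.comp (hf.prodMap hf)

theorem dis_nonneg_s8 (N M : PNetwork Z p) (π : Measure (N.carrier × M.carrier)) :
    0 ≤ dis p N.ω M.ω π := by
  unfold dis; positivity

theorem GWn_nonneg (N M : PNetwork Z p) : 0 ≤ GWn N M := by
  refine mul_nonneg (by norm_num) (Real.sInf_nonneg ?_)
  rintro _ ⟨π, -, rfl⟩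
  exact dis_nonneg_s8 N M π

variable [BorelSpace Z] [SecondCountableTopology Z]

theorem memLp_dist_iff {W : Type*} [MeasurableSpace W] {Q : Measure W} (hp : 1 ≤ p)
    {a b : W → Z} (ha : Measurable a) (hb : Measurable b) :
    MemLp (fun w => dist (a w) (b w)) (ENNReal.ofReal p) Q ↔
      ∫⁻ w, ENNReal.ofReal (dist (a w) (b w) ^ p) ∂Q < ∞ := by
  have h0 : 0 < p := by linarith
  rw [MemLp, eLpNorm_lt_top_iff_lintegral_rpow_enorm_lt_top (by simpa using h0)
    ENNReal.ofReal_ne_top, ENNReal.toReal_ofReal h0.le]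
  have : ∀ w, ‖dist (a w) (b w)‖ₑ ^ p = ENNReal.ofReal (dist (a w) (b w) ^ p) := fun w => by
    rw [Real.enorm_of_nonneg dist_nonneg, ENNReal.ofReal_rpow_of_nonneg dist_nonneg h0.le]
  simp only [this, (ha.dist hb).aestronglyMeasurable, true_and]

theorem PNetwork.exists_memLp_dist (N : PNetwork Z p) (hp : 1 ≤ p) :
    ∃ z₀ : Z, MemLp (fun w => dist (N.ω w) z₀) (ENNReal.ofReal p) (N.μ.prod N.μ) := by
  obtain ⟨z₀, hz⟩ := N.integ
  refine ⟨z₀, (memLp_dist_iff hp N.meas measurable_const).2 ?_⟩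
  rw [lintegral_prod _ (by have := N.meas; fun_prop)]
  exact hz

variable {Ω : Type*} [MeasurableSpace Ω] {P : Measure Ω} [IsProbabilityMeasure P]

theorem PNetwork.exists_eLpDist_pullback_lt_top (N : PNetwork Z p) (hp : 1 ≤ p)
    {f : Ω → N.carrier} (hf : MeasurePreserving f P N.μ) :
    ∃ z₀ : Z, eLpDist (N.pullback f) (fun _ => z₀) (ENNReal.ofReal p) (P.prod P) < ∞ := by
  obtain ⟨z₀, hz⟩ := N.exists_memLp_dist hp
  refine ⟨z₀, ?_⟩
  have := eLpDist_comp (q := ENNReal.ofReal p) N.meas (measurable_const (a := z₀)) (hf.prod hf)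
  exact this.trans_lt hz.2

theorem memLp_dist_pullback (hp : 1 ≤ p) {N M : PNetwork Z p} {f : Ω → N.carrier}
    {g : Ω → M.carrier} (hf : MeasurePreserving f P N.μ) (hg : MeasurePreserving g P M.μ) :
    MemLp (fun w => dist (N.pullback f w) (M.pullback g w)) (ENNReal.ofReal p) (P.prod P) := by
  have hfm := N.measurable_pullback hf.measurable
  have hgm := M.measurable_pullback hg.measurable
  have hq : 1 ≤ ENNReal.ofReal p := by simpa using hp
  obtain ⟨z, hz⟩ := N.exists_eLpDist_pullback_lt_top hp hf
  obtain ⟨z', hz'⟩ := M.exists_eLpDist_pullback_lt_top hp hg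
  refine ⟨(hfm.dist hgm).aestronglyMeasurable, ?_⟩
  refine (eLpDist_triangle hq hfm (measurable_const (a := z)) hgm).trans_lt
    (ENNReal.add_lt_top.2 ⟨hz, ?_⟩)
  refine (eLpDist_triangle hq measurable_const (measurable_const (a := z')) hgm).trans_lt
    (ENNReal.add_lt_top.2 ⟨?_, ?_⟩)
  · exact (memLp_const (dist z z')).2
  · simpa only [eLpDist, dist_comm] using hz'

theorem eLpDist_pullback_ne_top (hp : 1 ≤ p) {N M : PNetwork Z p} {f : Ω → N.carrier}
    {g : Ω → M.carrier} (hf : MeasurePreserving f P N.μ) (hg : MeasurePreserving g P M.μ) :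
    eLpDist (N.pullback f) (M.pullback g) (ENNReal.ofReal p) (P.prod P) ≠ ∞ :=
  (memLp_dist_pullback hp hf hg).2.ne

theorem dis_eq_toReal_eLpDist (hp : 1 ≤ p) {N M : PNetwork Z p}
    {π : Measure (N.carrier × M.carrier)} (hπ : π ∈ Couplings N.μ M.μ) :
    dis p N.ω M.ω π = (eLpDist (N.pullback Prod.fst) (M.pullback Prod.snd)
      (ENNReal.ofReal p) (π.prod π)).toReal := by
  obtain ⟨hprob, h1, h2⟩ := hπ
  have h0 : 0 < p := by linarith
  have hm := memLp_dist_pullback hp (P := π) (N := N) (M := M)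
    ⟨measurable_fst, h1⟩ ⟨measurable_snd, h2⟩
  have hi := hm.integrable_norm_rpow (by simpa using h0) ENNReal.ofReal_ne_top
  rw [eLpDist, hm.eLpNorm_eq_integral_rpow_norm (by simpa using h0) ENNReal.ofReal_ne_top,
    integral_prod _ hi, ENNReal.toReal_ofReal (by positivity), dis, one_div,
    ENNReal.toReal_ofReal h0.le]
  simp only [Real.norm_of_nonneg dist_nonneg]
  rfl

theorem dis_map_prodMk (hp : 1 ≤ p) {N M : PNetwork Z p} {f : Ω → N.carrier}
    {g : Ω → M.carrier} (hf : MeasurePreserving f P N.μ) (hg : MeasurePreserving g P M.μ) :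
    P.map (fun w => (f w, g w)) ∈ Couplings N.μ M.μ ∧
    dis p N.ω M.ω (P.map fun w => (f w, g w)) =
      (eLpDist (N.pullback f) (M.pullback g) (ENNReal.ofReal p) (P.prod P)).toReal := by
  have hfg : Measurable fun w => (f w, g w) := hf.measurable.prodMk hg.measurable
  have hmem : P.map (fun w => (f w, g w)) ∈ Couplings N.μ M.μ := by
    refine ⟨Measure.isProbabilityMeasure_map hfg.aemeasurable, ?_, ?_⟩
    · rw [Measure.map_map measurable_fst hfg]; exact hf.map_eq
    · rw [Measure.map_map measurable_snd hfg]; exact hg.map_eq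
  have := hmem.1
  refine ⟨hmem, ?_⟩
  have hφ : MeasurePreserving _ P (P.map fun w => (f w, g w)) := ⟨hfg, rfl⟩
  rw [dis_eq_toReal_eLpDist hp hmem, ← eLpDist_comp (N.measurable_pullback measurable_fst)
    (M.measurable_pullback measurable_snd) (hφ.prod hφ)]
  rfl

theorem two_mul_GWn_le (hp : 1 ≤ p) {N M : PNetwork Z p} {f : Ω → N.carrier}
    {g : Ω → M.carrier} (hf : MeasurePreserving f P N.μ) (hg : MeasurePreserving g P M.μ) :
    2 * GWn N M ≤
      (eLpDist (N.pullback f) (M.pullback g) (ENNReal.ofReal p) (P.prod P)).toReal := by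
  obtain ⟨hmem, hdis⟩ := dis_map_prodMk hp hf hg
  rw [← hdis, GWn, GW]
  have := csInf_le ⟨0, by rintro _ ⟨π, -, rfl⟩; exact dis_nonneg_s8 N M π⟩
    (Set.mem_image_of_mem (dis p N.ω M.ω) hmem)
  linarith

theorem exists_coupling_of_GWn_lt (hp : 1 ≤ p) {N M : PNetwork Z p} {ε : ℝ}
    (h : GWn N M < ε) : ∃ π ∈ Couplings N.μ M.μ,
      eLpDist (N.pullback Prod.fst) (M.pullback Prod.snd) (ENNReal.ofReal p) (π.prod π) <
        ENNReal.ofReal (2 * ε) := by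
  have hne : (dis p N.ω M.ω '' Couplings N.μ M.μ).Nonempty :=
    ⟨_, N.μ.prod M.μ, ⟨inferInstance, by simp, by simp⟩, rfl⟩
  rw [GWn, GW] at h
  obtain ⟨_, ⟨π, hπ, rfl⟩, hlt⟩ := exists_lt_of_csInf_lt hne
    (show sInf (dis p N.ω M.ω '' Couplings N.μ M.μ) < 2 * ε by linarith)
  have := hπ.1
  refine ⟨π, hπ, ?_⟩
  rw [dis_eq_toReal_eLpDist hp hπ] at hlt
  exact (ENNReal.lt_ofReal_iff_toReal_lt (eLpDist_pullback_ne_top hp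
    ⟨measurable_fst, hπ.2.1⟩ ⟨measurable_snd, hπ.2.2⟩)).2 hlt

/-- Any coupling can be realised over a given realisation of its first marginal, after adjoining an
independent uniform variable. -/
theorem exists_measurePreserving_of_GWn_lt (hp : 1 ≤ p) {N M : PNetwork Z p} {ε : ℝ}
    (h : GWn N M < ε) {f : Ω → N.carrier} (hf : MeasurePreserving f P N.μ) :
    ∃ g : Ω × I → M.carrier, MeasurePreserving g (P.prod volume) M.μ ∧
      eLpDist (N.pullback (f ∘ Prod.fst)) (M.pullback g) (ENNReal.ofReal p)
        ((P.prod volume).prod (P.prod volume)) < ENNReal.ofReal (2 * ε) := by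
  obtain ⟨π, hπ, hlt⟩ := exists_coupling_of_GWn_lt hp h
  have := hπ.1
  obtain ⟨F, hF, hmap⟩ := exists_measurable_map_prod_volume_eq π
  rw [hπ.2.1] at hmap
  have h1 : MeasurePreserving (Prod.map f id) (P.prod (volume : Measure I)) (N.μ.prod volume) :=
    hf.prod (MeasurePreserving.id _)
  have h2 : MeasurePreserving (fun q => (q.1, F q)) (N.μ.prod volume) π :=
    ⟨measurable_fst.prodMk hF, hmap⟩
  have h3 : MeasurePreserving Prod.snd π M.μ := ⟨measurable_snd, hπ.2.2⟩
  refine ⟨_, h3.comp (h2.comp h1), ?_⟩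
  rw [← eLpDist_comp (N.measurable_pullback measurable_fst)
    (M.measurable_pullback measurable_snd) ((h2.comp h1).prod (h2.comp h1))] at hlt
  exact hlt

theorem two_mul_GWn_lt_of_realization (hp : 1 ≤ p) {N M L : PNetwork Z p} {ε : ℝ}
    (h : GWn N M < ε) {f : Ω → N.carrier} (hf : MeasurePreserving f P N.μ)
    {g : Ω → L.carrier} (hg : MeasurePreserving g P L.μ) :
    2 * GWn M L < 2 * ε +
      (eLpDist (N.pullback f) (L.pullback g) (ENNReal.ofReal p) (P.prod P)).toReal := by
  obtain ⟨k, hk, hlt⟩ := exists_measurePreserving_of_GWn_lt hp h hf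
  have hε : 0 < ε := (GWn_nonneg N M).trans_lt h
  have hq : 1 ≤ ENNReal.ofReal p := by simpa using hp
  have hfst : MeasurePreserving Prod.fst (P.prod (volume : Measure I)) P :=
    measurePreserving_fst
  have hfm := N.measurable_pullback (hf.comp hfst).measurable
  have hgm := L.measurable_pullback (hg.comp hfst).measurable
  have hkm := M.measurable_pullback hk.measurable
  have hcomp := eLpDist_comp (q := ENNReal.ofReal p) (N.measurable_pullback hf.measurable)
    (L.measurable_pullback hg.measurable) (hfst.prod hfst)
  have hfin := eLpDist_pullback_ne_top hp hf hg
  refine (two_mul_GWn_le hp hk (hg.comp hfst)).trans_lt ?_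
  rw [← ENNReal.ofReal_lt_ofReal_iff_of_nonneg ENNReal.toReal_nonneg,
    ENNReal.ofReal_toReal (eLpDist_pullback_ne_top hp hk (hg.comp hfst)),
    ENNReal.ofReal_add (by positivity) ENNReal.toReal_nonneg, ENNReal.ofReal_toReal hfin]
  refine (eLpDist_triangle hq hkm hfm hgm).trans_lt
    (ENNReal.add_lt_add_of_lt_of_le ?_ ?_ hcomp.le)
  · rw [show eLpDist (N.pullback (f ∘ Prod.fst)) (L.pullback (g ∘ Prod.fst)) _ _ = _ from hcomp]
    exact hfin
  · simpa only [eLpDist, dist_comm] using hlt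

theorem exists_GWn_tendsto_of_cauchy [CompleteSpace Z] (hp : 1 ≤ p) (N : ℕ → PNetwork Z p)
    (hN : ∀ ε : ℝ, 0 < ε → ∃ n₀ : ℕ, ∀ n m : ℕ, n₀ ≤ n → n₀ ≤ m → GWn (N n) (N m) < ε) :
    ∃ L : PNetwork Z p, Tendsto (fun n => GWn (N n) L) atTop (𝓝 0) := by
  have hq : 1 ≤ ENNReal.ofReal p := by simpa using hp
  choose n₀ hn₀ using fun j : ℕ => hN ((1 / 2) ^ j) (by positivity)
  let k : ℕ → ℕ := fun j => (Finset.range (j + 1)).sup n₀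
  have hk : ∀ j, n₀ j ≤ k j := fun j => Finset.le_sup (f := n₀) (by simp)
  have hmono : Monotone k := fun i j hij => Finset.sup_mono (by grind)
  choose π hπ hdist using fun j => exists_coupling_of_GWn_lt hp
    (hn₀ j (k j) (k (j + 1)) (hk j) ((hk j).trans (hmono j.le_succ)))
  have : ∀ j, IsProbabilityMeasure (π j) := fun j => (hπ j).1
  obtain ⟨f, hf, hmap⟩ := exists_map_prodMk_succ_eq (fun j => (N (k j)).μ) π
    (fun j => (hπ j).2.1) (fun j => (hπ j).2.2)
  set P := Measure.infinitePi fun _ : ℕ => (volume : Measure I)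
  have hpair : ∀ j, MeasurePreserving (fun u => (f j u, f (j + 1) u)) P (π j) :=
    fun j => ⟨(hf j).prodMk (hf _), hmap j⟩
  have hlaw : ∀ j, MeasurePreserving (f j) P (N (k j)).μ := fun j =>
    have hfst : MeasurePreserving Prod.fst (π j) (N (k j)).μ := ⟨measurable_fst, (hπ j).2.1⟩
    hfst.comp (hpair j)
  let a : ℕ → (ℕ → I) × (ℕ → I) → Z := fun j => (N (k j)).pullback (f j)
  have ha : ∀ j, Measurable (a j) := fun j => (N (k j)).measurable_pullback (hf j)
  have hstep : ∀ j, eLpDist (a j) (a (j + 1)) (ENNReal.ofReal p) (P.prod P) ≤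
      ENNReal.ofReal (2 * (1 / 2) ^ j) := by
    intro j
    refine le_trans (le_of_eq ?_) (hdist j).le
    rw [← eLpDist_comp ((N (k j)).measurable_pullback measurable_fst)
      ((N (k (j + 1))).measurable_pullback measurable_snd) ((hpair j).prod (hpair j))]
    rfl
  have hsum : ∑' j : ℕ, ENNReal.ofReal (2 * (1 / 2) ^ j) ≠ ∞ :=
    (summable_geometric_two.mul_left 2).tsum_ofReal_ne_top
  obtain ⟨b, hb, hlim⟩ := exists_tendsto_eLpDist hq ha hsum hstep
  obtain ⟨j₀, hj₀⟩ := (hlim.eventually_lt_const ENNReal.zero_lt_top).exists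
  obtain ⟨z₀, hz₀⟩ := (N (k j₀)).exists_eLpDist_pullback_lt_top hp (hlaw j₀)
  have hbz : MemLp (fun w => dist (b w) z₀) (ENNReal.ofReal p) (P.prod P) := by
    refine ⟨(hb.dist measurable_const).aestronglyMeasurable, ?_⟩
    refine (eLpDist_triangle hq hb (ha j₀) measurable_const).trans_lt
      (ENNReal.add_lt_top.2 ⟨?_, hz₀⟩)
    simpa only [eLpDist, dist_comm] using hj₀
  let L : PNetwork Z p :=
    { carrier := ℕ → I
      μ := P
      ω := b
      prob := inferInstance
      meas := hb
      integ := by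
        refine ⟨z₀, ?_⟩
        rw [← lintegral_prod (fun w => ENNReal.ofReal (dist (b w) z₀ ^ p)) (by fun_prop)]
        exact (memLp_dist_iff hp hb measurable_const).1 hbz }
  have hid : MeasurePreserving id P L.μ := MeasurePreserving.id P
  refine ⟨L, Metric.tendsto_atTop.2 fun ε hε => ?_⟩
  obtain ⟨j, hj, hjε⟩ := ((hlim.eventually_lt_const
    (ENNReal.ofReal_pos.2 hε)).and (((tendsto_pow_atTop_nhds_zero_of_lt_one
      (by norm_num : (0 : ℝ) ≤ 1 / 2) (by norm_num)).eventually_lt_const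
      (half_pos hε)))).exists
  refine ⟨k j, fun m hm => ?_⟩
  rw [Real.dist_0_eq_abs, abs_of_nonneg (GWn_nonneg _ _)]
  have h1 := two_mul_GWn_lt_of_realization (L := L) (g := id) hp
    (hn₀ j (k j) m (hk j) ((hk j).trans hm)) (hlaw j) hid
  have h2 := (ENNReal.lt_ofReal_iff_toReal_lt hj.ne_top).1 hj
  have h3 : (eLpDist ((N (k j)).pullback (f j)) (L.pullback id) (ENNReal.ofReal p)
    (P.prod P)).toReal < ε := h2
  linarith

/-- The one-point network with constant kernel `z`. -/
noncomputable def PNetwork.point (p : ℝ) (hp : 1 ≤ p) (z : Z) : PNetwork Z p where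
  carrier := Unit
  μ := Measure.dirac ()
  ω := fun _ => z
  prob := inferInstance
  meas := measurable_const
  integ := ⟨z, by simp [Real.zero_rpow (by linarith : p ≠ 0)]⟩

theorem GWn_point_le (hp : 1 ≤ p) (z z' : Z) :
    2 * GWn (PNetwork.point p hp z) (PNetwork.point p hp z') ≤ dist z z' := by
  refine (two_mul_GWn_le hp (P := Measure.dirac ()) (N := PNetwork.point p hp z)
    (M := PNetwork.point p hp z') (MeasurePreserving.id _) (MeasurePreserving.id _)).trans ?_
  have h0 : ENNReal.ofReal p ≠ 0 := by simpa using (by linarith : 0 < p)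
  change (eLpNorm (fun _ => dist z z') _ _).toReal ≤ _
  rw [eLpNorm_const' _ h0 ENNReal.ofReal_ne_top]
  simp

theorem eLpDist_const_lt_of_GWn_point_lt (hp : 1 ≤ p) {z : Z} {L : PNetwork Z p} {ε : ℝ}
    (h : GWn (PNetwork.point p hp z) L < ε) :
    eLpDist (fun _ => z) L.ω (ENNReal.ofReal p) (L.μ.prod L.μ) < ENNReal.ofReal (2 * ε) := by
  obtain ⟨π, hπ, hlt⟩ := exists_coupling_of_GWn_lt hp h
  have := hπ.1
  have hsnd : MeasurePreserving Prod.snd π L.μ := ⟨measurable_snd, hπ.2.2⟩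
  rw [← eLpDist_comp (φ := Prod.map Prod.snd Prod.snd) measurable_const L.meas
    (hsnd.prod hsnd)]
  exact hlt

theorem completeSpace_of_GWn_complete (hp : 1 ≤ p)
    (H : ∀ N : ℕ → PNetwork Z p,
      (∀ ε : ℝ, 0 < ε → ∃ n₀ : ℕ, ∀ n m : ℕ, n₀ ≤ n → n₀ ≤ m → GWn (N n) (N m) < ε) →
      ∃ L : PNetwork Z p, Tendsto (fun n => GWn (N n) L) atTop (𝓝 0)) :
    CompleteSpace Z := by
  refine Metric.complete_of_cauchySeq_tendsto fun z hz => ?_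
  obtain ⟨L, hL⟩ := H (fun n => PNetwork.point p hp (z n)) fun ε hε => by
    obtain ⟨n₀, hn₀⟩ := Metric.cauchySeq_iff.1 hz ε hε
    refine ⟨n₀, fun n m hn hm => ?_⟩
    have h1 := GWn_point_le hp (z n) (z m)
    have h2 := hn₀ n hn m hm
    linarith
  have hlim : Tendsto (fun n => eLpDist (fun _ => z n) L.ω (ENNReal.ofReal p) (L.μ.prod L.μ))
      atTop (𝓝 0) := by
    refine ENNReal.tendsto_nhds_zero.2 fun ε hε => ?_
    obtain ⟨δ, hδ, hδε⟩ := ENNReal.lt_iff_exists_nnreal_btwn.1 hε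
    have hδ' : (0 : ℝ) < δ / 2 := by
      have : (0 : ℝ) < δ := by exact_mod_cast hδ
      positivity
    filter_upwards [hL.eventually_lt_const hδ'] with n hn
    refine (eLpDist_const_lt_of_GWn_point_lt hp hn).le.trans (le_trans (le_of_eq ?_) hδε.le)
    rw [mul_div_cancel₀ _ (two_ne_zero), ENNReal.ofReal_coe_nnreal]
  have h0 : ENNReal.ofReal p ≠ 0 := by simpa using (by linarith : 0 < p)
  have hmeas := tendstoInMeasure_of_tendsto_eLpNorm (μ := L.μ.prod L.μ) h0
    (f := fun n w => dist (z n) (L.ω w)) (g := fun _ => 0)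
    (fun n => (measurable_const.dist L.meas).aestronglyMeasurable) aestronglyMeasurable_const
    (by simpa [eLpDist, Pi.sub_def] using hlim)
  obtain ⟨ns, hns, hae⟩ := hmeas.exists_seq_tendsto_ae
  obtain ⟨w, hw⟩ := hae.exists
  exact ⟨L.ω w, tendsto_nhds_of_cauchySeq_of_subseq hz hns.tendsto_atTop
    (tendsto_iff_dist_tendsto_zero.2 hw)⟩

end Networks

/-- **Completeness transfer**: for a separable metric space `Z` and `p ∈ [1,∞)`, `Z` is
complete if and only if every `GW_p^Z`-Cauchy sequence of `(Z,p)`-networks converges to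
some `(Z,p)`-network in `GW_p^Z`. -/
theorem complete_iff_gw_complete
    {Z : Type*} [MetricSpace Z] [MeasurableSpace Z] [BorelSpace Z]
    [TopologicalSpace.SeparableSpace Z]
    (p : ℝ) (hp : 1 ≤ p) :
    CompleteSpace Z ↔
      ∀ N : ℕ → PNetwork Z p,
        (∀ ε : ℝ, 0 < ε → ∃ n₀ : ℕ, ∀ n m : ℕ, n₀ ≤ n → n₀ ≤ m → GWn (N n) (N m) < ε) →
        ∃ L : PNetwork Z p,
          Filter.Tendsto (fun n => GWn (N n) L) Filter.atTop (nhds 0) := by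
  have := UniformSpace.secondCountable_of_separable Z
  exact ⟨fun _ => exists_GWn_tendsto_of_cauchy hp, completeSpace_of_GWn_complete hp⟩
end

section
/- Failure of geodesicity for the discrete two-point target: Let Z = {0,1} with the discrete metric (d_Z(0,1) = 1) and let p > 1. Let X = ({⋆}, ω₀, δ_⋆) and Y = ({⋆}, ω₁, δ_⋆) be the one-point (Z,p)-networks with ω₀(⋆,⋆) = 0 and ω₁(⋆,⋆) = 1. Then GW_p^Z(X, Y) = 1/2, and there is NO (Z,p)-network M = (M, ω_M, μ_M) satisfying GW_p^Z(X, M) = GW_p^Z(Y, M) = 1/4; in particular the space of (Z,p)-networks with the GW_p^Z distance is not geodesic for p > 1. -/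
open MeasureTheory

/-- The two-point metric space `{0, 1}` (as a subspace of `ℝ`, so that
`dist 0 1 = 1`: the discrete metric). -/
abbrev TwoPt : Type := ({0, 1} : Set ℝ)

/-- The point `0` of `TwoPt`. -/
def TwoPt.zero : TwoPt := ⟨0, by simp⟩

/-- The point `1` of `TwoPt`. -/
def TwoPt.one : TwoPt := ⟨1, by simp⟩

/-- A measure on `Unit × Y` is the only coupling of its marginals, so the distortion of a
coupling with a one-point space is an integral over `Y` alone. -/
lemma dis_eq_of_mem_couplings_unit {Y Z : Type*} [MeasurableSpace Y] [PseudoMetricSpace Z]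
    (p : ℝ) (z : Z) (ωY : Y × Y → Z) {μ : Measure Y} {π : Measure (Unit × Y)}
    (hπ : π ∈ Couplings (Measure.dirac ()) μ) :
    dis p (fun _ : Unit × Unit => z) ωY π =
      (∫ y, ∫ y', dist z (ωY (y, y')) ^ p ∂μ ∂μ) ^ (1 / p) := by
  obtain ⟨-, -, rfl⟩ := hπ
  have hsnd : MeasurableEmbedding (Prod.snd : Unit × Y → Y) :=
    (MeasurableEquiv.mk (Equiv.punitProd Y) measurable_snd
      measurable_prodMk_left).measurableEmbedding
  simp only [dis, hsnd.integral_map]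

/-- The product measure is a coupling with a one-point space. -/
lemma couplings_unit_nonempty {Y : Type*} [MeasurableSpace Y] (μ : Measure Y)
    [IsProbabilityMeasure μ] : (Couplings (Measure.dirac ()) μ).Nonempty :=
  ⟨(Measure.dirac ()).prod μ, inferInstance, by simp, by simp⟩

/-- The Gromov–Wasserstein distance from a one-point network. -/
lemma GW_unit {Y Z : Type*} [MeasurableSpace Y] [MeasurableSpace Z] [PseudoMetricSpace Z]
    (p : ℝ) (z : Z) (ωY : Y × Y → Z) (μ : Measure Y) [IsProbabilityMeasure μ] :
    GW p (fun _ : Unit × Unit => z) (Measure.dirac ()) ωY μ =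
      1 / 2 * (∫ y, ∫ y', dist z (ωY (y, y')) ^ p ∂μ ∂μ) ^ (1 / p) := by
  have himage : dis p (fun _ : Unit × Unit => z) ωY '' Couplings (Measure.dirac ()) μ =
      {(∫ y, ∫ y', dist z (ωY (y, y')) ^ p ∂μ ∂μ) ^ (1 / p)} := by
    rw [Set.image_congr fun π hπ => dis_eq_of_mem_couplings_unit p z ωY hπ,
      (couplings_unit_nonempty μ).image_const]
  rw [GW, himage, csInf_singleton]

lemma TwoPt.dist_zero_rpow {p : ℝ} (hp : p ≠ 0) (z : TwoPt) :
    dist TwoPt.zero z ^ p = (z : ℝ) := by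
  obtain ⟨z, rfl | rfl⟩ := z <;> simp [Subtype.dist_eq, TwoPt.zero, hp]

lemma TwoPt.dist_one_rpow {p : ℝ} (hp : p ≠ 0) (z : TwoPt) :
    dist TwoPt.one z ^ p = 1 - (z : ℝ) := by
  obtain ⟨z, rfl | rfl⟩ := z <;> simp [Subtype.dist_eq, TwoPt.one, hp]

/-- The `p`-th powers of the distortions from the two one-point networks add up to `1`. -/
lemma integral_dist_zero_add_integral_dist_one {Y : Type*} [MeasurableSpace Y]
    {p : ℝ} (hp : p ≠ 0) {ω : Y × Y → TwoPt} (hω : Measurable ω) (μ : Measure Y)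
    [IsProbabilityMeasure μ] :
    (∫ y, ∫ y', dist TwoPt.zero (ω (y, y')) ^ p ∂μ ∂μ) +
      ∫ y, ∫ y', dist TwoPt.one (ω (y, y')) ^ p ∂μ ∂μ = 1 := by
  have hint : Integrable (fun w => (ω w : ℝ)) (μ.prod μ) := by
    refine .of_bound (measurable_subtype_coe.comp hω).aestronglyMeasurable 1
      (.of_forall fun w => ?_)
    obtain h | h := (ω w).2 <;> simp_all
  simp only [TwoPt.dist_zero_rpow hp, TwoPt.dist_one_rpow hp]
  rw [← integral_prod _ hint,
    ← integral_prod (fun w => 1 - (ω w : ℝ)) ((integrable_const 1).sub hint), integral_sub (integrable_const 1) hint]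
  simp

/-- **Failure of geodesicity for the discrete two-point target**: for `Z = {0,1}` with
the discrete metric and `p > 1`, the one-point networks `X` and `Y` with constant
kernels `0` and `1` satisfy `GW_p^Z(X,Y) = 1/2`, and no `(Z,p)`-network `M` is a
midpoint, i.e. satisfies `GW_p^Z(X,M) = GW_p^Z(Y,M) = 1/4`; in particular the space of
`(Z,p)`-networks with `GW_p^Z` is not geodesic for `p > 1`. -/
theorem gw_two_point_not_geodesic
    (p : ℝ) (hp : 1 < p) :
    GW p (fun _ : Unit × Unit => TwoPt.zero) (Measure.dirac ())
        (fun _ : Unit × Unit => TwoPt.one) (Measure.dirac ()) = 1 / 2 ∧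
    ¬ ∃ M : PNetwork TwoPt p,
        GW p (fun _ : Unit × Unit => TwoPt.zero) (Measure.dirac ()) M.ω M.μ = 1 / 4 ∧
        GW p (fun _ : Unit × Unit => TwoPt.one) (Measure.dirac ()) M.ω M.μ = 1 / 4 := by
  have hp0 : p ≠ 0 := by positivity
  refine ⟨?_, ?_⟩
  · rw [GW_unit]
    simp [TwoPt.dist_zero_rpow hp0, TwoPt.one]
  · rintro ⟨M, hX, hY⟩
    have := M.prob
    rw [GW_unit] at hX hY
    have hsum := integral_dist_zero_add_integral_dist_one hp0 M.meas M.μ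
    have hroot {a : ℝ} (ha : 0 ≤ a) (h : 1 / 2 * a ^ (1 / p) = 1 / 4) : a < 1 / 2 := by
      have hhalf : a ^ (1 / p) = 1 / 2 := by linarith
      have hpow : a = (1 / 2) ^ p := by
        rw [← hhalf, one_div, Real.rpow_inv_rpow ha hp0]
      rw [hpow]
      exact Real.rpow_lt_self_of_lt_one (by norm_num) (by norm_num) hp
    have hnonneg (z : TwoPt) : 0 ≤ ∫ y, ∫ y', dist z (M.ω (y, y')) ^ p ∂M.μ ∂M.μ :=
      integral_nonneg fun _ => integral_nonneg fun _ => by positivity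
    linarith [hroot (hnonneg _) hX, hroot (hnonneg _) hY]
end
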